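/- Let n ∈ ℕ, s ∈ ℂ, λ ∈ {1, −1}, and let φ be holomorphic on ℂ ∖ (−∞, 0] satisfying the Lewis equation φ(z) = φ(z + 1) + λ z^{−2s} φ(1 + 1/z) for all z ∈ ℂ ∖ (−∞, 0]. Define φ̃(z) := Σ n^s (cz + d)^{−2s} φ((az + b)/(cz + d)), the sum running over all matrices (a, b; c, d) ∈ S_n with gcd(a, b, c, d) = 1. Then φ̃ is holomorphic on ℂ ∖ (−∞, 0] and satisfies the same Lewis equation φ̃(z) = φ̃(z + 1) + λ z^{−2s} φ̃(1 + 1/z) for all z ∈ ℂ ∖ (−∞, 0]. -/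

import Mathlib

/-- The cut `(−∞, r]` on the real axis, as a subset of `ℂ`. -/
def cut (r : ℝ) : Set ℂ := {z : ℂ | z.re ≤ r ∧ z.im = 0}

/-- `φ̃(z) = Σ n^s (cz + d)^{−2s} φ((az + b)/(cz + d))`, the sum over all
matrices `(a, b; c, d) ∈ S_n` (i.e. `a > c ≥ 0`, `d > b ≥ 0`, `ad − bc = n`)
with `gcd(a, b, c, d) = 1`; every such matrix has entries `≤ n`. -/
noncomputable def heckeSum (n : ℕ) (s : ℂ) (φ : ℂ → ℂ) (z : ℂ) : ℂ :=
  ∑ a ∈ Finset.range (n + 1), ∑ b ∈ Finset.range (n + 1),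
    ∑ c ∈ Finset.range (n + 1), ∑ d ∈ Finset.range (n + 1),
      if c < a ∧ b < d ∧ a * d = n + b * c ∧
          Nat.gcd (Nat.gcd a b) (Nat.gcd c d) = 1 then
        (n : ℂ) ^ s * ((c : ℂ) * z + (d : ℂ)) ^ (-(2 * s)) *
          φ (((a : ℂ) * z + (b : ℂ)) / ((c : ℂ) * z + (d : ℂ)))
      else 0

section helpers
open Complex

def St (n : ℕ) (N : ℕ × ℕ × ℕ × ℕ) : Prop :=
  N.2.2.1 < N.1 ∧ N.2.1 < N.2.2.2 ∧ N.1 * N.2.2.2 = n + N.2.1 * N.2.2.1 ∧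
    ∀ k, k ∣ N.1 → k ∣ N.2.1 → k ∣ N.2.2.1 → k ∣ N.2.2.2 → k = 1

lemma gcd4 (a b c d : ℕ) : Nat.gcd (Nat.gcd a b) (Nat.gcd c d) = 1 ↔
    ∀ k, k ∣ a → k ∣ b → k ∣ c → k ∣ d → k = 1 := by
  constructor
  · intro h k ha hb hc hd
    have := Nat.dvd_gcd (Nat.dvd_gcd ha hb) (Nat.dvd_gcd hc hd)
    rw [h] at this
    exact Nat.dvd_one.1 this
  · intro h
    have h1 := Nat.gcd_dvd_left (Nat.gcd a b) (Nat.gcd c d)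
    have h2 := Nat.gcd_dvd_right (Nat.gcd a b) (Nat.gcd c d)
    exact h _ (h1.trans (Nat.gcd_dvd_left _ _)) (h1.trans (Nat.gcd_dvd_right _ _))
      (h2.trans (Nat.gcd_dvd_left _ _)) (h2.trans (Nat.gcd_dvd_right _ _))

lemma ratio (x y : ℂ) (hx : x ∈ slitPlane) (hy : y ∈ slitPlane)
    (h : (0 ≤ x.im ∧ 0 ≤ y.im) ∨ (x.im ≤ 0 ∧ y.im ≤ 0)) :
    x / y ∈ slitPlane ∧ log (x / y) = log x - log y := by
  have hx0 := slitPlane_ne_zero hx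
  have hy0 := slitPlane_ne_zero hy
  have e : x / y = exp (log x - log y) := by
    rw [exp_sub, exp_log hx0, exp_log hy0]
  have bx1 := neg_pi_lt_arg x
  have by1 := neg_pi_lt_arg y
  have bx2 := lt_of_le_of_ne (arg_le_pi x) (mem_slitPlane_iff_arg.1 hx).1
  have by2 := lt_of_le_of_ne (arg_le_pi y) (mem_slitPlane_iff_arg.1 hy).1
  have key : -Real.pi < arg x - arg y ∧ arg x - arg y < Real.pi := by
    rcases h with ⟨h1, h2⟩ | ⟨h1, h2⟩
    · have := arg_nonneg_iff.2 h1
      have := arg_nonneg_iff.2 h2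
      constructor <;> linarith
    · have n1 : ∀ w : ℂ, w ∈ slitPlane → w.im ≤ 0 → arg w ≤ 0 := by
        intro w hw hi
        rcases hi.lt_or_eq with hi | hi
        · exact (arg_neg_iff.2 hi).le
        · rw [mem_slitPlane_iff] at hw
          have : 0 < w.re := by
            rcases hw with hw | hw
            · exact hw
            · exact absurd hi hw
          exact (arg_eq_zero_iff.2 ⟨this.le, hi⟩).le
      have := n1 x hx h1
      have := n1 y hy h2
      constructor <;> linarith
  have el : log (x / y) = log x - log y := by
    rw [e, log_exp]
    · simpa [log_im] using key.1
    · simpa [log_im] using key.2.le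
  refine ⟨mem_slitPlane_iff_arg.2 ⟨?_, div_ne_zero hx0 hy0⟩, el⟩
  have := congrArg Complex.im el
  simp only [log_im, sub_im] at this
  rw [this]
  exact key.2.ne

lemma cut_iff (z : ℂ) : z ∉ cut 0 ↔ z ∈ slitPlane := by
  rw [mem_slitPlane_iff]
  simp only [cut, Set.mem_ofPred_eq, not_and_or, not_le, ne_eq]

/-- linear forms -/
lemma lin_mem (z : ℂ) (hz : z ∈ slitPlane) (a b : ℕ) (h : 0 < a ∨ 0 < b) :
    (a : ℂ) * z + b ∈ slitPlane ∧
    (0 ≤ z.im → 0 ≤ ((a : ℂ) * z + b).im) ∧ (z.im ≤ 0 → ((a : ℂ) * z + b).im ≤ 0) := by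
  have hi : ((a : ℂ) * z + b).im = a * z.im := by simp
  have hr : ((a : ℂ) * z + b).re = a * z.re + b := by simp
  have ha : (0 : ℝ) ≤ a := a.cast_nonneg
  have hb : (0 : ℝ) ≤ b := b.cast_nonneg
  refine ⟨?_, ?_, ?_⟩
  · rw [mem_slitPlane_iff] at hz ⊢
    rw [hi, hr]
    rcases Nat.eq_zero_or_pos a with h0 | h0
    · subst h0
      left
      have : 0 < b := by simpa using h
      simpa using this
    · have h0' : (0 : ℝ) < a := by exact_mod_cast h0
      rcases hz with hz | hz
      · left; positivity
      · right; positivity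
  · intro h; rw [hi]; positivity
  · intro h; rw [hi]; exact mul_nonpos_of_nonneg_of_nonpos ha h

lemma lin_ratio (z : ℂ) (hz : z ∈ slitPlane) (a b c d : ℕ) (h : 0 < a ∨ 0 < b) (h' : 0 < c ∨ 0 < d) :
    ((a : ℂ) * z + b) / ((c : ℂ) * z + d) ∈ slitPlane ∧
    ∀ p : ℂ, (((a : ℂ) * z + b) / ((c : ℂ) * z + d)) ^ p * ((c : ℂ) * z + d) ^ p
      = ((a : ℂ) * z + b) ^ p := by
  obtain ⟨h1, h2, h3⟩ := lin_mem z hz a b h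
  obtain ⟨k1, k2, k3⟩ := lin_mem z hz c d h'
  obtain ⟨r1, r2⟩ := ratio _ _ h1 k1 (by
    rcases le_total 0 z.im with hh | hh
    · exact Or.inl ⟨h2 hh, k2 hh⟩
    · exact Or.inr ⟨h3 hh, k3 hh⟩)
  refine ⟨r1, fun p => ?_⟩
  rw [cpow_def_of_ne_zero (slitPlane_ne_zero r1), cpow_def_of_ne_zero (slitPlane_ne_zero k1),
    cpow_def_of_ne_zero (slitPlane_ne_zero h1), r2, ← exp_add]
  congr 1; ring

/-- homogenized -/
noncomputable def GG (s : ℂ) (φ : ℂ → ℂ) (z : ℂ) (a b c d : ℕ) : ℂ :=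
  ((c : ℂ) * z + d) ^ (-(2 * s)) * φ (((a : ℂ) * z + b) / ((c : ℂ) * z + d))

lemma GG_lewis (s lam : ℂ) (φ : ℂ → ℂ)
    (hLewis : ∀ z ∈ slitPlane,
      φ z = φ (z + 1) + lam * z ^ (-(2 * s)) * φ (1 + 1 / z)) (z : ℂ) (hz : z ∈ slitPlane)
    (a b c d : ℕ) (h : 0 < a ∨ 0 < b) (h' : 0 < c ∨ 0 < d) :
    GG s φ z a b c d = GG s φ z (a + c) (b + d) c d + lam * GG s φ z (a + c) (b + d) a b := by
  obtain ⟨r1, r2⟩ := lin_ratio z hz a b c d h h'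
  have hx := slitPlane_ne_zero (lin_mem z hz a b h).1
  have hy := slitPlane_ne_zero (lin_mem z hz c d h').1
  have := hLewis _ r1
  unfold GG
  rw [this, ← r2 (-(2 * s))]
  push_cast
  have e1 : ((a : ℂ) * z + b) / ((c : ℂ) * z + d) + 1 =
    ((a + c : ℂ) * z + (b + d)) / ((c : ℂ) * z + d) := by
    rw [div_add_one hy]; congr 1; ring
  have e2 : 1 + 1 / (((a : ℂ) * z + b) / ((c : ℂ) * z + d)) =
    ((a + c : ℂ) * z + (b + d)) / ((a : ℂ) * z + b) := by
    rw [one_div_div, one_add_div hx]; congr 1; ring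
  rw [e1, e2]
  ring

lemma GG_symm (s lam : ℂ) (hlam : lam = 1 ∨ lam = -1) (φ : ℂ → ℂ)
    (hLewis : ∀ z ∈ slitPlane,
      φ z = φ (z + 1) + lam * z ^ (-(2 * s)) * φ (1 + 1 / z)) (z : ℂ) (hz : z ∈ slitPlane)
    (a b c d : ℕ) (h : 0 < a ∨ 0 < b) (h' : 0 < c ∨ 0 < d) :
    lam * GG s φ z a b c d = GG s φ z c d a b := by
  rw [GG_lewis s lam φ hLewis z hz a b c d h h', GG_lewis s lam φ hLewis z hz c d a b h' h,
    add_comm c a, add_comm d b]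
  rcases hlam with rfl | rfl <;> ring

lemma GG_three (s lam : ℂ) (hlam : lam = 1 ∨ lam = -1) (φ : ℂ → ℂ)
    (hLewis : ∀ z ∈ slitPlane,
      φ z = φ (z + 1) + lam * z ^ (-(2 * s)) * φ (1 + 1 / z)) (z : ℂ) (hz : z ∈ slitPlane)
    (a b c d : ℕ) (h : 0 < a ∨ 0 < b) (h' : 0 < c ∨ 0 < d) :
    GG s φ z a b c d = GG s φ z (a + c) (b + d) c d + GG s φ z a b (a + c) (b + d) := by
  rw [GG_lewis s lam φ hLewis z hz a b c d h h', 
    GG_symm s lam hlam φ hLewis z hz (a + c) (b + d) a b (by omega) h]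

open Classical in
/-- The index set. -/
noncomputable def SS (n : ℕ) : Finset (ℕ × ℕ × ℕ × ℕ) :=
  ((Finset.range (n + 1)) ×ˢ (Finset.range (n + 1)) ×ˢ (Finset.range (n + 1)) ×ˢ
    (Finset.range (n + 1))).filter (St n)

lemma St_bound {n a b c d : ℕ} (h : St n (a, b, c, d)) :
    a ≤ n ∧ b ≤ n ∧ c ≤ n ∧ d ≤ n := by
  obtain ⟨h1, h2, h3, -⟩ := h
  simp only at h1 h2 h3
  obtain ⟨e, rfl⟩ := Nat.exists_eq_add_of_lt h1
  obtain ⟨f, rfl⟩ := Nat.exists_eq_add_of_lt h2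
  have : n = c * (f + 1) + (e + 1) * b + (e + 1) * (f + 1) := by
    nlinarith
  refine ⟨?_, ?_, ?_, ?_⟩ <;> nlinarith [Nat.zero_le (c * f), Nat.zero_le (e * b), Nat.zero_le (e * f)]

lemma mem_SS {n a b c d : ℕ} : (a, b, c, d) ∈ SS n ↔ c < a ∧ b < d ∧ a * d = n + b * c ∧
    ∀ k, k ∣ a → k ∣ b → k ∣ c → k ∣ d → k = 1 := by
  have : (a, b, c, d) ∈ SS n ↔ St n (a, b, c, d) := by
    classical
    simp only [SS]
    rw [Finset.mem_filter]
    refine ⟨fun h => h.2, fun h => ⟨?_, h⟩⟩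
    have := St_bound h
    simp only [Finset.mem_product, Finset.mem_range]
    omega
  rw [this]; rfl

lemma det_int {n a b c d : ℕ} : a * d = n + b * c ↔ (a : ℤ) * d = n + b * c := by
  norm_cast

/-- Right descent decomposition. -/
lemma descent (n : ℕ) (H : ℕ → ℕ → ℕ → ℕ → ℂ) :
    ∑ A ∈ SS n, (H A.1 A.2.1 A.2.2.1 A.2.2.2 - H A.1 (A.1 + A.2.1) A.2.2.1 (A.2.2.1 + A.2.2.2)
      - H (A.1 + A.2.1) A.2.1 (A.2.2.1 + A.2.2.2) A.2.2.2) =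
    ∑ A ∈ SS n with A.2.1 < A.1 ∧ A.2.2.1 < A.2.2.2, H A.1 A.2.1 A.2.2.1 A.2.2.2
    - ∑ A ∈ SS n with A.2.2.1 + A.2.2.2 ≤ A.1 + A.2.1,
        H A.1 (A.1 + A.2.1) A.2.2.1 (A.2.2.1 + A.2.2.2)
    - ∑ A ∈ SS n with A.1 + A.2.1 ≤ A.2.2.1 + A.2.2.2,
        H (A.1 + A.2.1) A.2.1 (A.2.2.1 + A.2.2.2) A.2.2.2 := by
  have e1 : ∑ A ∈ SS n, H A.1 A.2.1 A.2.2.1 A.2.2.2 =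
      ∑ A ∈ SS n with A.2.1 < A.1 ∧ A.2.2.1 < A.2.2.2, H A.1 A.2.1 A.2.2.1 A.2.2.2
      + ∑ A ∈ SS n with A.1 ≤ A.2.1, H A.1 A.2.1 A.2.2.1 A.2.2.2
      + ∑ A ∈ SS n with A.2.2.2 ≤ A.2.2.1, H A.1 A.2.1 A.2.2.1 A.2.2.2 := by
    simp only [Finset.sum_filter]
    rw [← Finset.sum_add_distrib, ← Finset.sum_add_distrib]
    refine Finset.sum_congr rfl ?_
    rintro ⟨a, b, c, d⟩ h
    obtain ⟨h1, h2, -, -⟩ := mem_SS.1 h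
    simp only
    by_cases q1 : a ≤ b
    · rw [if_neg (by omega), if_pos q1, if_neg (by omega)]; ring
    · by_cases q2 : d ≤ c
      · rw [if_neg (by omega), if_neg q1, if_pos q2]; ring
      · rw [if_pos (by omega), if_neg q1, if_neg q2]; ring
  have e2 : ∑ A ∈ SS n, H A.1 (A.1 + A.2.1) A.2.2.1 (A.2.2.1 + A.2.2.2) =
      ∑ A ∈ SS n with A.1 + A.2.1 < A.2.2.1 + A.2.2.2,
        H A.1 (A.1 + A.2.1) A.2.2.1 (A.2.2.1 + A.2.2.2)
      + ∑ A ∈ SS n with A.2.2.1 + A.2.2.2 ≤ A.1 + A.2.1,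
        H A.1 (A.1 + A.2.1) A.2.2.1 (A.2.2.1 + A.2.2.2) := by
    rw [← Finset.sum_filter_add_sum_filter_not (SS n)
      (fun A => A.1 + A.2.1 < A.2.2.1 + A.2.2.2)]
    simp only [not_lt]
  have e3 : ∑ A ∈ SS n, H (A.1 + A.2.1) A.2.1 (A.2.2.1 + A.2.2.2) A.2.2.2 =
      ∑ A ∈ SS n with A.2.2.1 + A.2.2.2 < A.1 + A.2.1,
        H (A.1 + A.2.1) A.2.1 (A.2.2.1 + A.2.2.2) A.2.2.2
      + ∑ A ∈ SS n with A.1 + A.2.1 ≤ A.2.2.1 + A.2.2.2,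
        H (A.1 + A.2.1) A.2.1 (A.2.2.1 + A.2.2.2) A.2.2.2 := by
    rw [← Finset.sum_filter_add_sum_filter_not (SS n)
      (fun A => A.2.2.1 + A.2.2.2 < A.1 + A.2.1)]
    simp only [not_lt]
  have b2 : ∑ A ∈ SS n with A.1 + A.2.1 < A.2.2.1 + A.2.2.2,
        H A.1 (A.1 + A.2.1) A.2.2.1 (A.2.2.1 + A.2.2.2) =
      ∑ A ∈ SS n with A.1 ≤ A.2.1, H A.1 A.2.1 A.2.2.1 A.2.2.2 := by
    refine Finset.sum_nbij' (fun A => (A.1, A.1 + A.2.1, A.2.2.1, A.2.2.1 + A.2.2.2))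
      (fun A => (A.1, A.2.1 - A.1, A.2.2.1, A.2.2.2 - A.2.2.1)) ?_ ?_ ?_ ?_ ?_
    · rintro ⟨a, b, c, d⟩ h
      rw [Finset.mem_filter, mem_SS] at h ⊢
      obtain ⟨⟨h1, h2, h3, h4⟩, h5⟩ := h
      simp only at h5 ⊢
      refine ⟨⟨h1, h5, by linarith, fun k ka kb kc kd => h4 k ka ?_ kc ?_⟩, by omega⟩
      · exact (Nat.dvd_add_right ka).1 kb
      · exact (Nat.dvd_add_right kc).1 kd
    · rintro ⟨a, b, c, d⟩ h
      rw [Finset.mem_filter, mem_SS] at h ⊢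
      obtain ⟨⟨h1, h2, h3, h4⟩, h5⟩ := h
      simp only at h5 ⊢
      obtain ⟨b, rfl⟩ := Nat.exists_eq_add_of_le h5
      obtain ⟨d, rfl⟩ := Nat.exists_eq_add_of_le (show c ≤ d by omega)
      rw [Nat.add_sub_cancel_left, Nat.add_sub_cancel_left]
      refine ⟨⟨h1, by omega, by linarith, fun k ka kb kc kd => h4 k ka ?_ kc ?_⟩, by omega⟩
      · exact Nat.dvd_add ka kb
      · exact Nat.dvd_add kc kd
    · rintro ⟨a, b, c, d⟩ h
      simp
    · rintro ⟨a, b, c, d⟩ h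
      rw [Finset.mem_filter, mem_SS] at h
      simp only [Prod.mk.injEq, true_and, and_true] at h ⊢
      omega
    · intros; rfl
  have b3 : ∑ A ∈ SS n with A.2.2.1 + A.2.2.2 < A.1 + A.2.1,
        H (A.1 + A.2.1) A.2.1 (A.2.2.1 + A.2.2.2) A.2.2.2 =
      ∑ A ∈ SS n with A.2.2.2 ≤ A.2.2.1, H A.1 A.2.1 A.2.2.1 A.2.2.2 := by
    refine Finset.sum_nbij' (fun A => (A.1 + A.2.1, A.2.1, A.2.2.1 + A.2.2.2, A.2.2.2))
      (fun A => (A.1 - A.2.1, A.2.1, A.2.2.1 - A.2.2.2, A.2.2.2)) ?_ ?_ ?_ ?_ ?_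
    · rintro ⟨a, b, c, d⟩ h
      rw [Finset.mem_filter, mem_SS] at h ⊢
      obtain ⟨⟨h1, h2, h3, h4⟩, h5⟩ := h
      simp only at h5 ⊢
      refine ⟨⟨h5, h2, by linarith, fun k ka kb kc kd => h4 k ?_ kb ?_ kd⟩, by omega⟩
      · exact (Nat.dvd_add_left kb).1 ka
      · exact (Nat.dvd_add_left kd).1 kc
    · rintro ⟨a, b, c, d⟩ h
      rw [Finset.mem_filter, mem_SS] at h ⊢
      obtain ⟨⟨h1, h2, h3, h4⟩, h5⟩ := h
      simp only at h5 ⊢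
      obtain ⟨c, rfl⟩ := Nat.exists_eq_add_of_le h5
      obtain ⟨a, rfl⟩ := Nat.exists_eq_add_of_le (show b ≤ a by omega)
      rw [Nat.add_sub_cancel_left, Nat.add_sub_cancel_left]
      refine ⟨⟨by omega, h2, by linarith, fun k ka kb kc kd => h4 k ?_ kb ?_ kd⟩, by omega⟩
      · exact Nat.dvd_add kb ka
      · exact Nat.dvd_add kd kc
    · rintro ⟨a, b, c, d⟩ h
      simp
    · rintro ⟨a, b, c, d⟩ h
      rw [Finset.mem_filter, mem_SS] at h
      simp only [Prod.mk.injEq, true_and, and_true] at h ⊢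
      omega
    · intros; rfl
  rw [Finset.sum_sub_distrib, Finset.sum_sub_distrib, e1, e2, e3, b2, b3]
  ring

/-- The main combinatorial identity. -/
lemma comb (n : ℕ) (G : ℕ → ℕ → ℕ → ℕ → ℂ)
    (hG : ∀ a b c d, (0 < a ∨ 0 < b) → (0 < c ∨ 0 < d) →
      G a b c d = G (a + c) (b + d) c d + G a b (a + c) (b + d)) :
    ∑ A ∈ SS n, (G A.1 A.2.1 A.2.2.1 A.2.2.2 - G A.1 (A.1 + A.2.1) A.2.2.1 (A.2.2.1 + A.2.2.2)
      - G (A.1 + A.2.1) A.2.1 (A.2.2.1 + A.2.2.2) A.2.2.2) = 0 := by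
  have z0 : ∑ A ∈ SS n, (G A.1 A.2.2.1 A.2.1 A.2.2.2
      - G A.1 A.2.2.1 (A.1 + A.2.1) (A.2.2.1 + A.2.2.2)
      - G (A.1 + A.2.1) (A.2.2.1 + A.2.2.2) A.2.1 A.2.2.2) = 0 := by
    refine Finset.sum_eq_zero ?_
    rintro ⟨a, b, c, d⟩ h
    rw [mem_SS] at h
    simp only
    rw [hG a c b d (by omega) (by omega)]
    ring
  have dt := descent n (fun a b c d => G a c b d)
  rw [z0] at dt
  have c0 : ∑ A ∈ SS n with A.2.1 < A.1 ∧ A.2.2.1 < A.2.2.2, G A.1 A.2.1 A.2.2.1 A.2.2.2 =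
      ∑ A ∈ SS n with A.2.1 < A.1 ∧ A.2.2.1 < A.2.2.2, G A.1 A.2.2.1 A.2.1 A.2.2.2 := by
    refine Finset.sum_nbij' (fun A => (A.1, A.2.2.1, A.2.1, A.2.2.2))
      (fun A => (A.1, A.2.2.1, A.2.1, A.2.2.2)) ?_ ?_ ?_ ?_ ?_
    · rintro ⟨a, b, c, d⟩ h
      rw [Finset.mem_filter, mem_SS] at h ⊢
      obtain ⟨⟨h1, h2, h3, h4⟩, h5⟩ := h
      simp only at h5 ⊢
      exact ⟨⟨h5.1, h5.2, by linarith, fun k ka kb kc kd => h4 k ka kc kb kd⟩, h1, h2⟩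
    · rintro ⟨a, b, c, d⟩ h
      rw [Finset.mem_filter, mem_SS] at h ⊢
      obtain ⟨⟨h1, h2, h3, h4⟩, h5⟩ := h
      simp only at h5 ⊢
      exact ⟨⟨h5.1, h5.2, by linarith, fun k ka kb kc kd => h4 k ka kc kb kd⟩, h1, h2⟩
    · intros; rfl
    · intros; rfl
    · intros; rfl
  have c1 : ∑ A ∈ SS n with A.2.2.1 + A.2.2.2 ≤ A.1 + A.2.1,
        G A.1 (A.1 + A.2.1) A.2.2.1 (A.2.2.1 + A.2.2.2) =
      ∑ A ∈ SS n with A.1 + A.2.1 ≤ A.2.2.1 + A.2.2.2,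
        G (A.1 + A.2.1) (A.2.2.1 + A.2.2.2) A.2.1 A.2.2.2 := by
    refine Finset.sum_nbij'
      (fun A => (A.1 - A.2.2.1, A.2.2.1, A.1 + A.2.1 - (A.2.2.1 + A.2.2.2), A.2.2.1 + A.2.2.2))
      (fun A => (A.1 + A.2.1, A.2.2.1 + A.2.2.2 - (A.1 + A.2.1), A.2.1, A.2.2.2 - A.2.1))
      ?_ ?_ ?_ ?_ ?_
    · rintro ⟨a, b, c, d⟩ h
      rw [Finset.mem_filter, mem_SS] at h ⊢
      obtain ⟨⟨h1, h2, h3, h4⟩, h5⟩ := h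
      simp only at h5 ⊢
      obtain ⟨a, rfl⟩ := Nat.exists_eq_add_of_le h1.le
      obtain ⟨e, he⟩ := Nat.exists_eq_add_of_le h5
      have hab : a + b = d + e := by omega
      rw [he, Nat.add_sub_cancel_left, Nat.add_sub_cancel_left]
      refine ⟨⟨by omega, by omega, by nlinarith, fun k ka kb kc kd => ?_⟩, by omega⟩
      have k1 : k ∣ d := (Nat.dvd_add_right kb).1 kd
      exact h4 k (Nat.dvd_add kb ka) ((Nat.dvd_add_right ka).1 (hab ▸ Nat.dvd_add k1 kc)) kb k1
    · rintro ⟨a, b, c, d⟩ h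
      rw [Finset.mem_filter, mem_SS] at h ⊢
      obtain ⟨⟨h1, h2, h3, h4⟩, h5⟩ := h
      simp only at h5 ⊢
      obtain ⟨d, rfl⟩ := Nat.exists_eq_add_of_le h2.le
      obtain ⟨e, he⟩ := Nat.exists_eq_add_of_le h5
      have hab : c + d = a + e := by omega
      rw [he, Nat.add_sub_cancel_left, Nat.add_sub_cancel_left]
      refine ⟨⟨by omega, by omega, by nlinarith, fun k ka kb kc kd => ?_⟩, by omega⟩
      have k1 : k ∣ a := (Nat.dvd_add_left kc).1 ka
      exact h4 k k1 kc ((Nat.dvd_add_left kd).1 (hab ▸ Nat.dvd_add k1 kb)) (Nat.dvd_add kc kd)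
    · rintro ⟨a, b, c, d⟩ h
      rw [Finset.mem_filter, mem_SS] at h
      simp only [Prod.mk.injEq, true_and, and_true] at h ⊢
      omega
    · rintro ⟨a, b, c, d⟩ h
      rw [Finset.mem_filter, mem_SS] at h
      simp only [Prod.mk.injEq, true_and, and_true] at h ⊢
      omega
    · rintro ⟨a, b, c, d⟩ h
      rw [Finset.mem_filter, mem_SS] at h
      simp only at h ⊢
      congr 1 <;> omega
  have c2 : ∑ A ∈ SS n with A.1 + A.2.1 ≤ A.2.2.1 + A.2.2.2,
        G (A.1 + A.2.1) A.2.1 (A.2.2.1 + A.2.2.2) A.2.2.2 =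
      ∑ A ∈ SS n with A.2.2.1 + A.2.2.2 ≤ A.1 + A.2.1,
        G A.1 A.2.2.1 (A.1 + A.2.1) (A.2.2.1 + A.2.2.2) := by
    refine Finset.sum_nbij'
      (fun A => (A.1 + A.2.1, A.2.2.1 + A.2.2.2 - (A.1 + A.2.1), A.2.1, A.2.2.2 - A.2.1))
      (fun A => (A.1 - A.2.2.1, A.2.2.1, A.1 + A.2.1 - (A.2.2.1 + A.2.2.2), A.2.2.1 + A.2.2.2))
      ?_ ?_ ?_ ?_ ?_
    · rintro ⟨a, b, c, d⟩ h
      rw [Finset.mem_filter, mem_SS] at h ⊢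
      obtain ⟨⟨h1, h2, h3, h4⟩, h5⟩ := h
      simp only at h5 ⊢
      obtain ⟨d, rfl⟩ := Nat.exists_eq_add_of_le h2.le
      obtain ⟨e, he⟩ := Nat.exists_eq_add_of_le h5
      have hab : c + d = a + e := by omega
      rw [he, Nat.add_sub_cancel_left, Nat.add_sub_cancel_left]
      refine ⟨⟨by omega, by omega, by nlinarith, fun k ka kb kc kd => ?_⟩, by omega⟩
      have k1 : k ∣ a := (Nat.dvd_add_left kc).1 ka
      exact h4 k k1 kc ((Nat.dvd_add_left kd).1 (hab ▸ Nat.dvd_add k1 kb)) (Nat.dvd_add kc kd)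
    · rintro ⟨a, b, c, d⟩ h
      rw [Finset.mem_filter, mem_SS] at h ⊢
      obtain ⟨⟨h1, h2, h3, h4⟩, h5⟩ := h
      simp only at h5 ⊢
      obtain ⟨a, rfl⟩ := Nat.exists_eq_add_of_le h1.le
      obtain ⟨e, he⟩ := Nat.exists_eq_add_of_le h5
      have hab : a + b = d + e := by omega
      rw [he, Nat.add_sub_cancel_left, Nat.add_sub_cancel_left]
      refine ⟨⟨by omega, by omega, by nlinarith, fun k ka kb kc kd => ?_⟩, by omega⟩
      have k1 : k ∣ d := (Nat.dvd_add_right kb).1 kd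
      exact h4 k (Nat.dvd_add kb ka) ((Nat.dvd_add_right ka).1 (hab ▸ Nat.dvd_add k1 kc)) kb k1
    · rintro ⟨a, b, c, d⟩ h
      rw [Finset.mem_filter, mem_SS] at h
      simp only [Prod.mk.injEq, true_and, and_true] at h ⊢
      omega
    · rintro ⟨a, b, c, d⟩ h
      rw [Finset.mem_filter, mem_SS] at h
      simp only [Prod.mk.injEq, true_and, and_true] at h ⊢
      omega
    · rintro ⟨a, b, c, d⟩ h
      rw [Finset.mem_filter, mem_SS] at h
      simp only at h ⊢
      congr 1 <;> omega
  rw [descent n G, c0, c1, c2, dt]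
  ring

/-- Reindexing by conjugation with the flip. -/
lemma flip_sum (n : ℕ) (H : ℕ → ℕ → ℕ → ℕ → ℂ) :
    ∑ A ∈ SS n, H A.1 A.2.1 A.2.2.1 A.2.2.2 = ∑ A ∈ SS n, H A.2.2.2 A.2.2.1 A.2.1 A.1 := by
  refine Finset.sum_nbij' (fun A => (A.2.2.2, A.2.2.1, A.2.1, A.1))
    (fun A => (A.2.2.2, A.2.2.1, A.2.1, A.1)) ?_ ?_ ?_ ?_ ?_
  · rintro ⟨a, b, c, d⟩ h
    rw [mem_SS] at h ⊢
    exact ⟨h.2.1, h.1, by linarith [h.2.2.1], fun k ka kb kc kd => h.2.2.2 k kd kc kb ka⟩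
  · rintro ⟨a, b, c, d⟩ h
    rw [mem_SS] at h ⊢
    exact ⟨h.2.1, h.1, by linarith [h.2.2.1], fun k ka kb kc kd => h.2.2.2 k kd kc kb ka⟩
  · intros; rfl
  · intros; rfl
  · intros; rfl

lemma heckeSum_eq (n : ℕ) (s : ℂ) (φ : ℂ → ℂ) (z : ℂ) :
    heckeSum n s φ z = (n : ℂ) ^ s * ∑ A ∈ SS n, GG s φ z A.1 A.2.1 A.2.2.1 A.2.2.2 := by
  classical
  simp only [heckeSum, SS, Finset.sum_filter, Finset.sum_product, Finset.mul_sum]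
  refine Finset.sum_congr rfl fun a _ => Finset.sum_congr rfl fun b _ =>
    Finset.sum_congr rfl fun c _ => Finset.sum_congr rfl fun d _ => ?_
  simp only [gcd4]
  by_cases h : St n (a, b, c, d)
  · rw [if_pos h, if_pos (show c < a ∧ _ from h)]
    simp only [GG, mul_assoc]
  · rw [if_neg h, if_neg (show ¬ (c < a ∧ _) from h), mul_zero]

end helpers

/-- Theorem 8.1: if `φ` is holomorphic on `ℂ ∖ (−∞, 0]` and solves the Lewis
equation `φ(z) = φ(z + 1) + λ z^{−2s} φ(1 + 1/z)` with `λ = ±1`, then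
`φ̃ = Σ_{A ∈ S_n, gcd = 1} n^s (cz+d)^{−2s} φ((az+b)/(cz+d))` is holomorphic on
`ℂ ∖ (−∞, 0]` and satisfies the same Lewis equation. -/
theorem heckeSum_solves_lewis (n : ℕ) (s lam : ℂ) (hlam : lam = 1 ∨ lam = -1)
    (φ : ℂ → ℂ) (hφ : DifferentiableOn ℂ φ (cut 0)ᶜ)
    (hLewis : ∀ z ∉ cut 0,
      φ z = φ (z + 1) + lam * z ^ (-(2 * s)) * φ (1 + 1 / z)) :
    DifferentiableOn ℂ (heckeSum n s φ) (cut 0)ᶜ ∧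
    ∀ z ∉ cut 0,
      heckeSum n s φ z =
        heckeSum n s φ (z + 1) + lam * z ^ (-(2 * s)) * heckeSum n s φ (1 + 1 / z) := by
  have hL : ∀ z ∈ Complex.slitPlane,
      φ z = φ (z + 1) + lam * z ^ (-(2 * s)) * φ (1 + 1 / z) :=
    fun z hz => hLewis z ((cut_iff z).2 hz)
  have hc : (cut 0)ᶜ = Complex.slitPlane := by
    ext z; exact cut_iff z
  constructor
  · rw [hc] at hφ ⊢
    have : heckeSum n s φ =
        fun z => (n : ℂ) ^ s * ∑ A ∈ SS n, GG s φ z A.1 A.2.1 A.2.2.1 A.2.2.2 := by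
      funext z; exact heckeSum_eq n s φ z
    rw [this]
    refine DifferentiableOn.const_mul (DifferentiableOn.fun_sum ?_) _
    rintro ⟨a, b, c, d⟩ h
    rw [mem_SS] at h
    have l1 : 0 < a ∨ 0 < b := by omega
    have l2 : 0 < c ∨ 0 < d := by omega
    have d1 : DifferentiableOn ℂ (fun z : ℂ => (a : ℂ) * z + b) Complex.slitPlane := by fun_prop
    have d2 : DifferentiableOn ℂ (fun z : ℂ => (c : ℂ) * z + d) Complex.slitPlane := by fun_prop
    refine DifferentiableOn.mul (d2.cpow (differentiableOn_const _)
      (fun z hz => (lin_mem z hz c d l2).1)) ?_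
    exact hφ.comp (d1.div d2 (fun z hz => Complex.slitPlane_ne_zero (lin_mem z hz c d l2).1))
      (fun z hz => (lin_ratio z hz a b c d l1 l2).1)
  · intro z hz
    rw [cut_iff] at hz
    have hz0 := Complex.slitPlane_ne_zero hz
    have hc := comb n (GG s φ z) (GG_three s lam hlam φ hL z hz)
    rw [Finset.sum_sub_distrib, Finset.sum_sub_distrib] at hc
    have h1 : ∑ A ∈ SS n, GG s φ (z + 1) A.1 A.2.1 A.2.2.1 A.2.2.2 =
        ∑ A ∈ SS n, GG s φ z A.1 (A.1 + A.2.1) A.2.2.1 (A.2.2.1 + A.2.2.2) := by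
      refine Finset.sum_congr rfl fun A _ => ?_
      simp only [GG]
      push_cast
      congr 2
      · ring
      · congr 1 <;> ring
    have h2 : lam * z ^ (-(2 * s)) * ∑ A ∈ SS n, GG s φ (1 + 1 / z) A.1 A.2.1 A.2.2.1 A.2.2.2 =
        ∑ A ∈ SS n, GG s φ z (A.1 + A.2.1) A.2.1 (A.2.2.1 + A.2.2.2) A.2.2.2 := by
      rw [flip_sum n (fun a b c d => GG s φ z (a + b) b (c + d) d), Finset.mul_sum]
      refine Finset.sum_congr rfl ?_
      rintro ⟨a, b, c, d⟩ h
      rw [mem_SS] at h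
      simp only
      rw [← GG_symm s lam hlam φ hL z hz (b + a) a (d + c) c (by omega) (by omega), mul_assoc]
      congr 1
      have hy := Complex.slitPlane_ne_zero (lin_mem z hz (d + c) c (by omega)).1
      have r := (lin_ratio z hz (d + c) c 1 0 (by omega) (by omega)).2 (-(2 * s))
      have e1 : (c : ℂ) * (1 + 1 / z) + d = (((d + c : ℕ) : ℂ) * z + c) / z := by
        push_cast; field_simp; ring
      have e2 : (a : ℂ) * (1 + 1 / z) + b = (((b + a : ℕ) : ℂ) * z + a) / z := by
        push_cast; field_simp; ring
      simp only [GG]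
      rw [e1, e2, div_div_div_cancel_right₀ hz0, ← r]
      simp only [Nat.cast_one, Nat.cast_zero, one_mul, add_zero]
      ring
    rw [heckeSum_eq, heckeSum_eq, heckeSum_eq, h1]
    linear_combination (n : ℂ) ^ s * hc - (n : ℂ) ^ s * h2
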